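/- Let G be a finitely generated group, E an admissible family of subgroups of G, T a minimal E-tree, and Y a cylinder of T with associated commensurability class C. Then the map S ↦ [X_S] induces an isomorphism of Boolean algebras from the Boolean algebra B_Y of equivalence classes of special forests based on Y onto B_C(T). In particular, for H in C, the set X_S is H-finite if and only if the special forest S is finite. -/

import Mathlib

open scoped Pointwise symmDiff

namespace SSRN

section Group
variable {G : Type*} [Group G]

/-- A subset of `G` is `H`-finite if it is contained in finitely many orbits of the
action of `H` on `G` by left multiplication. -/
def HFin (H : Subgroup G) (X : Set G) : Prop :=
  ∃ F : Finset G, X ⊆ ⋃ f ∈ F, (· * f) '' (H : Set G)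

/-- Two subsets of `G` are `H`-equivalent if their symmetric difference is `H`-finite. -/
def AIEquiv (H : Subgroup G) (X Y : Set G) : Prop := HFin H (X ∆ Y)

/-- `X` is an `H`-almost invariant subset of `G`. -/
def IsAI (H : Subgroup G) (X : Set G) : Prop :=
  (∀ h ∈ H, (h * ·) '' X = X) ∧ ∀ s : G, HFin H (((· * s) '' X) ∆ X)

/-- `X` is a non-trivial `H`-almost invariant subset of `G`. -/
def NontrivAI (H : Subgroup G) (X : Set G) : Prop :=
  IsAI H X ∧ ¬ HFin H X ∧ ¬ HFin H Xᶜ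

/-- The `H`-almost invariant set `X` crosses `Y`: none of the four corners is `H`-finite. -/
def Crosses (H : Subgroup G) (X Y : Set G) : Prop :=
  ¬ HFin H (X ∩ Y) ∧ ¬ HFin H (X ∩ Yᶜ) ∧ ¬ HFin H (Xᶜ ∩ Y) ∧ ¬ HFin H (Xᶜ ∩ Yᶜ)

/-- Crossing of (non-trivial) almost invariant sets, quantifying over the groups over
which they are almost invariant. -/
def CrossesAny (X X' : Set G) : Prop :=
  ∃ H K : Subgroup G, NontrivAI H X ∧ NontrivAI K X' ∧ Crosses H X X'

/-- `X` and `X'` determine the same unordered pair `{[X], [X*]}` of equivalence classes. -/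
def SamePair (X X' : Set G) : Prop :=
  ∃ H : Subgroup G, NontrivAI H X ∧ (HFin H (X ∆ X') ∨ HFin H (X ∆ X'ᶜ))

/-- An admissible family of subgroups: conjugacy invariant, closed under commensurability,
and no member contains another with infinite index. -/
def Admissible (E : Set (Subgroup G)) : Prop :=
  (∀ H ∈ E, ∀ g : G, (MulAut.conj g • H) ∈ E) ∧
  (∀ H ∈ E, ∀ K : Subgroup G, Subgroup.Commensurable K H → K ∈ E) ∧
  (∀ A ∈ E, ∀ B ∈ E, A ≤ B → A.relIndex B ≠ 0)

end Group

section Tree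

variable {V : Type*}

/-- The stabilizer of an edge `e : Sym2 V` under the action of `G`. -/
def edgeStab (G : Type*) [Group G] [MulAction G V] (e : Sym2 V) : Subgroup G where
  carrier := {g | Sym2.map (g • ·) e = e}
  one_mem' := by
    show Sym2.map ((1 : G) • ·) e = e
    have : ((1 : G) • · : V → V) = id := by funext v; simp
    rw [this, Sym2.map_id]; rfl
  mul_mem' := by
    intro a b ha hb
    show Sym2.map ((a * b) • ·) e = e
    have : ((a * b) • · : V → V) = (a • ·) ∘ (b • ·) := by funext v; simp [mul_smul]
    rw [this, ← Sym2.map_map, hb, ha]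
  inv_mem' := by
    intro a ha
    show Sym2.map (a⁻¹ • ·) e = e
    conv_lhs => rw [← ha]
    rw [Sym2.map_map]
    have : ((a⁻¹ • ·) ∘ (a • ·) : V → V) = id := by funext v; simp
    rw [this, Sym2.map_id]; rfl

variable (T : SimpleGraph V)

/-- `G` acts on the graph `T` by graph automorphisms. -/
def ActsOn (G : Type*) [Group G] [MulAction G V] : Prop :=
  ∀ (g : G) (u v : V), T.Adj u v → T.Adj (g • u) (g • v)

/-- The action of `G` on `T` is without inversions. -/
def NoInversions (G : Type*) [Group G] [MulAction G V] : Prop :=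
  ∀ (g : G) (u v : V), T.Adj u v → ¬ (g • u = v ∧ g • v = u)

/-- `w` lies between `u` and `v`: it is on every path from `u` to `v`. -/
def Btw (u w v : V) : Prop := ∀ p : T.Walk u v, p.IsPath → w ∈ p.support

/-- The action of `G` on the tree `T` is minimal: every nonempty invariant subtree
(convex invariant set of vertices) is the whole vertex set. -/
def MinimalAction (G : Type*) [Group G] [MulAction G V] : Prop :=
  ∀ A : Set V, A.Nonempty → (∀ (g : G), ∀ a ∈ A, g • a ∈ A) →
    (∀ u ∈ A, ∀ v ∈ A, ∀ w : V, Btw T u w v → w ∈ A) → A = Set.univ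

/-- The action of `G` is non-trivial: there is no global fixed vertex. -/
def NontrivialAction (G : Type*) [Group G] [MulAction G V] : Prop :=
  ¬ ∃ v : V, ∀ g : G, g • v = v

/-- `T` is an `E`-tree: all edge stabilizers belong to `E`. -/
def IsETree (G : Type*) [Group G] [MulAction G V] (E : Set (Subgroup G)) : Prop :=
  ∀ e ∈ T.edgeSet, edgeStab G e ∈ E

/-- There are finitely many `G`-orbits of edges. -/
def FinEdgeOrbits (G : Type*) [Group G] [MulAction G V] : Prop :=
  ∃ F : Finset (Sym2 V), ∀ e ∈ T.edgeSet, ∃ e₀ ∈ F, ∃ g : G, Sym2.map (g • ·) e₀ = e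

/-- A cylinder of `T`: an equivalence class of edges for commensurability of stabilizers. -/
def IsCylinder (G : Type*) [Group G] [MulAction G V] (Y : Set (Sym2 V)) : Prop :=
  Y.Nonempty ∧ Y ⊆ T.edgeSet ∧
    ∀ e ∈ Y, ∀ e' ∈ T.edgeSet,
      (e' ∈ Y ↔ Subgroup.Commensurable (edgeStab G e) (edgeStab G (V := V) e'))

/-- The set of vertices of a set of edges (e.g. of a cylinder). -/
def cylVerts (Y : Set (Sym2 V)) : Set V := {v | ∃ e ∈ Y, v ∈ e}

/-- The boundary of a cylinder: its vertices lying in another cylinder,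
i.e. incident to an edge outside the cylinder. -/
def cylBoundary (Y : Set (Sym2 V)) : Set V :=
  {v | v ∈ cylVerts Y ∧ ∃ e ∈ T.edgeSet, v ∈ e ∧ e ∉ Y}

/-- `H` belongs to the commensurability class associated to the cylinder `Y`. -/
def InClassOf (G : Type*) [Group G] [MulAction G V] (Y : Set (Sym2 V)) (H : Subgroup G) : Prop :=
  ∃ e ∈ Y, Subgroup.Commensurable H (edgeStab G e)

/-- The coboundary of a set of vertices: edges with exactly one endpoint in it. -/
def cobdry (S : Set V) : Set (Sym2 V) :=
  {e | e ∈ T.edgeSet ∧ ∃ u v : V, e = s(u, v) ∧ u ∈ S ∧ v ∉ S}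

/-- `S` is a special forest based on the cylinder `Y`. -/
def IsSpecialForest (S : Set V) (Y : Set (Sym2 V)) : Prop :=
  (cobdry T S).Finite ∧ cobdry T S ⊆ Y

/-- A set of vertices is non-trivial if it is neither finite nor cofinite. -/
def NontrivForest (S : Set V) : Prop := ¬ S.Finite ∧ ¬ (Sᶜ : Set V).Finite

/-- The almost invariant set associated to a set of vertices. -/
def XS (G : Type*) [Group G] [MulAction G V] (v₀ : V) (S : Set V) : Set G :=
  {g : G | g • v₀ ∈ S}

/-- The component `T_e` of `T` minus the open edge `e = s(u,v)` containing the terminal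
vertex `v`. -/
def halfTree (u v : V) : Set V :=
  {w | ∃ p : T.Walk v w, p.IsPath ∧ s(u, v) ∉ p.edges}

/-- The almost invariant set `Z_e` dual to the oriented edge `(u, v)`. -/
def Ze (G : Type*) [Group G] [MulAction G V] (v₀ u v : V) : Set G :=
  XS G v₀ (halfTree T u v)

/-- `v` has finitely many incident edges in `Y`. -/
def FiniteValenceIn (Y : Set (Sym2 V)) (v : V) : Prop := {e | e ∈ Y ∧ v ∈ e}.Finite

/-- The peripheral special forest `S_{v,Y}`: the component of `v` in `T` minus the open
edges of `Y` incident to `v`. -/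
def periForest (Y : Set (Sym2 V)) (v : V) : Set V :=
  {w | ∃ p : T.Walk v w, p.IsPath ∧ ∀ e ∈ Y, v ∈ e → e ∉ p.edges}

/-- The peripheral almost invariant set `X_{v,Y}`. -/
def XvY (G : Type*) [Group G] [MulAction G V] (v₀ : V) (Y : Set (Sym2 V)) (v : V) : Set G :=
  XS G v₀ (periForest T Y v)

/-- A peripheral special forest: one equivalent to some `S_{v,Y}`. -/
def PeripheralForest (G : Type*) [Group G] [MulAction G V] (S : Set V) : Prop :=
  ∃ (Y : Set (Sym2 V)) (v : V), IsCylinder T G Y ∧ v ∈ cylBoundary T Y ∧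
    FiniteValenceIn Y v ∧ (S ∆ periForest T Y v).Finite

/-- The Boolean algebra `B_C(T)` of (representatives of) almost invariant sets based on the
cylinder `Y`: the smallest family containing the sets `Z_e`, `e ∈ Y`, closed under
complement, intersection and `H`-equivalence. -/
def BCT {G : Type*} [Group G] [MulAction G V] (v₀ : V) (Y : Set (Sym2 V)) (H : Subgroup G) :
    Set (Set G) :=
  ⋂₀ {F : Set (Set G) |
    (∀ u v : V, T.Adj u v → s(u, v) ∈ Y → Ze T G v₀ u v ∈ F) ∧
    (∀ X ∈ F, Xᶜ ∈ F) ∧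
    (∀ X ∈ F, ∀ X' ∈ F, X ∩ X' ∈ F) ∧
    (∀ X ∈ F, ∀ X' : Set G, HFin H (X ∆ X') → X' ∈ F)}

/-- The set `B(T)` of (representatives of) almost invariant sets based on `T`. -/
def BT (G : Type*) [Group G] [MulAction G V] (v₀ : V) : Set (Set G) :=
  {X | ∃ Y : Set (Sym2 V), IsCylinder T G Y ∧ ∃ e ∈ Y, X ∈ BCT T v₀ Y (edgeStab G e)}

/-- Elements of `B(T)` that are non-trivial almost invariant sets. -/
def NontrivB (G : Type*) [Group G] [MulAction G V] (v₀ : V) : Set (Set G) :=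
  {X | X ∈ BT T G v₀ ∧ ∃ H : Subgroup G, NontrivAI H X}

/-- One step of the relation generating cross-connected components. -/
def ccStep (G : Type*) [Group G] [MulAction G V] (v₀ : V) (X X' : Set G) : Prop :=
  X ∈ NontrivB T G v₀ ∧ X' ∈ NontrivB T G v₀ ∧ (CrossesAny X X' ∨ SamePair X X')

/-- The equivalence relation generated by crossing (and identification of equivalent sets
and complements) on `B(T)`. -/
def ccRel (G : Type*) [Group G] [MulAction G V] (v₀ : V) : Set G → Set G → Prop :=
  Relation.EqvGen (ccStep T G v₀)

/-- The cross-connected component of (the pair determined by) `X`. -/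
def ccOf (G : Type*) [Group G] [MulAction G V] (v₀ : V) (X : Set G) : Set (Set G) :=
  {X' | ccRel T G v₀ X X'}

/-- `C` is a cross-connected component of `B(T)`. -/
def IsCCC (G : Type*) [Group G] [MulAction G V] (v₀ : V) (C : Set (Set G)) : Prop :=
  ∃ X ∈ NontrivB T G v₀, C = ccOf T G v₀ X

/-- A cross-connected component is based on the cylinder `Y` if its members are almost
invariant over subgroups in the commensurability class of `Y`. -/
def CCCBasedOn (G : Type*) [Group G] [MulAction G V] (Y : Set (Sym2 V)) (C : Set (Set G)) :
    Prop :=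
  ∃ X ∈ C, ∃ H : Subgroup G, InClassOf G Y H ∧ NontrivAI H X

/-- A peripheral cross-connected component. -/
def PeripheralCCC (G : Type*) [Group G] [MulAction G V] (v₀ : V) (C : Set (Set G)) : Prop :=
  ∃ (Y : Set (Sym2 V)) (v : V), IsCylinder T G Y ∧ v ∈ cylBoundary T Y ∧
    FiniteValenceIn Y v ∧ XvY T G v₀ Y v ∈ C

/-- Betweenness of (distinct) cross-connected components. -/
def CCCBetween {G : Type*} [Group G] (C₁ C₂ C₃ : Set (Set G)) : Prop :=
  C₁ ≠ C₂ ∧ C₂ ≠ C₃ ∧ C₁ ≠ C₃ ∧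
    ∃ X₁ ∈ C₁, ∃ X₂ ∈ C₂, ∃ X₃ ∈ C₃, X₁ ⊆ X₂ ∧ X₂ ⊆ X₃

/-- A star of cross-connected components. -/
def IsStar (G : Type*) [Group G] [MulAction G V] (v₀ : V) (St : Set (Set (Set G))) : Prop :=
  (∀ C ∈ St, IsCCC T G v₀ C) ∧ St.Nontrivial ∧
  (∀ C ∈ St, ∀ C' ∈ St, ∀ C'' : Set (Set G), IsCCC T G v₀ C'' → ¬ CCCBetween C C'' C') ∧
  (∀ St' : Set (Set (Set G)), St ⊆ St' → (∀ C ∈ St', IsCCC T G v₀ C) →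
    (∀ C ∈ St', ∀ C' ∈ St', ∀ C'' : Set (Set G), IsCCC T G v₀ C'' → ¬ CCCBetween C C'' C') →
    St' = St)

/-- The regular neighbourhood `RN(B(T))`: the bipartite graph on cross-connected
components and stars. -/
def RNGraph (G : Type*) [Group G] [MulAction G V] (v₀ : V) :
    SimpleGraph ({C : Set (Set G) // IsCCC T G v₀ C} ⊕
      {St : Set (Set (Set G)) // IsStar T G v₀ St}) where
  Adj x y :=
    match x, y with
    | Sum.inl C, Sum.inr St => C.1 ∈ St.1
    | Sum.inr St, Sum.inl C => C.1 ∈ St.1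
    | _, _ => False
  symm := ⟨by rintro (C | St) (C' | St') h <;> exact h⟩
  loopless := ⟨by rintro (C | St) h <;> exact h⟩

/-- Vertices of `T` lying in at least two cylinders. -/
def TcV0 (G : Type*) [Group G] [MulAction G V] : Set V :=
  {v | ∃ Y Y' : Set (Sym2 V), IsCylinder T G Y ∧ IsCylinder T G Y' ∧ Y ≠ Y' ∧
    v ∈ cylVerts Y ∧ v ∈ cylVerts Y'}

/-- The tree of cylinders `T_c` of `T`, as a bipartite graph. -/
def TcGraph (G : Type*) [Group G] [MulAction G V] :
    SimpleGraph ({v : V // v ∈ TcV0 T G} ⊕ {Y : Set (Sym2 V) // IsCylinder T G Y}) where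
  Adj x y :=
    match x, y with
    | Sum.inl v, Sum.inr Y => v.1 ∈ cylVerts Y.1
    | Sum.inr Y, Sum.inl v => v.1 ∈ cylVerts Y.1
    | _, _ => False
  symm := ⟨by rintro (v | Y) (v' | Y') h <;> exact h⟩
  loopless := ⟨by rintro (v | Y) h <;> exact h⟩


/-- `T` dominates `T'`: there is a `G`-equivariant map. -/
def Dominates (G : Type*) [Group G] {V V' : Type*} [MulAction G V] [MulAction G V']
    (T : SimpleGraph V) (T' : SimpleGraph V') : Prop :=
  ∃ f : V → V', ∀ (g : G) (x : V), f (g • x) = g • f x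

end Tree

section Subdiv

variable {α β : Type*}

/-- `S` is a subdivision of `Γ` via the vertex embedding `f`. -/
def SubdivVia (f : α → β) (S : SimpleGraph β) (Γ : SimpleGraph α) : Prop :=
  Function.Injective f ∧
  (∀ b : β, b ∉ Set.range f → ∃ x y : β, x ≠ y ∧ S.neighborSet b = {x, y}) ∧
  (∀ u : α, Nonempty (Γ.neighborSet u ≃ S.neighborSet (f u))) ∧
  (∀ u v : α, Γ.Adj u v ↔ ∃ p : S.Walk (f u) (f v), p.IsPath ∧ 1 ≤ p.length ∧
      ∀ w ∈ p.support, w ∈ Set.range f → w = f u ∨ w = f v) ∧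
  (∀ e ∈ S.edgeSet, ∃ (u v : α) (p : S.Walk (f u) (f v)), Γ.Adj u v ∧ p.IsPath ∧
      (∀ w ∈ p.support, w ∈ Set.range f → w = f u ∨ w = f v) ∧ e ∈ p.edges)

/-- `S` is (isomorphic to) a subdivision of `Γ`. -/
def IsSubdivision (S : SimpleGraph β) (Γ : SimpleGraph α) : Prop :=
  ∃ f : α → β, SubdivVia f S Γ

end Subdiv

end SSRN

namespace SSRN

section HFinLemmas
variable {G : Type*} [Group G]

theorem hfin_iff (H : Subgroup G) (X : Set G) :
    HFin H X ↔ ∃ F : Finset G, ∀ x ∈ X, ∃ f ∈ F, ∃ h ∈ H, h * f = x := by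
  have key : ∀ (F : Finset G) (x : G), (x ∈ ⋃ f ∈ F, (· * f) '' (H : Set G)) ↔
      ∃ f ∈ F, ∃ h ∈ H, h * f = x := fun F x => by
    simp only [Set.mem_iUnion, Set.mem_image, SetLike.mem_coe, exists_prop]
  exact exists_congr fun F => forall₂_congr fun x _ => key F x

theorem hfin_mono {H : Subgroup G} {X X' : Set G} (h : X ⊆ X') (hX : HFin H X') : HFin H X := by
  obtain ⟨F, hF⟩ := hX
  exact ⟨F, h.trans hF⟩

theorem hfin_union {H : Subgroup G} {X X' : Set G} (hX : HFin H X) (hX' : HFin H X') :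
    HFin H (X ∪ X') := by
  classical
  rw [hfin_iff] at *
  obtain ⟨F, hF⟩ := hX
  obtain ⟨F', hF'⟩ := hX'
  refine ⟨F ∪ F', ?_⟩
  rintro x (hx | hx)
  · obtain ⟨f, hf, h⟩ := hF x hx
    exact ⟨f, Finset.mem_union_left _ hf, h⟩
  · obtain ⟨f, hf, h⟩ := hF' x hx
    exact ⟨f, Finset.mem_union_right _ hf, h⟩

theorem hfin_empty (H : Subgroup G) : HFin H (∅ : Set G) := ⟨∅, by simp⟩

theorem hfin_biUnion {ι : Type*} {H : Subgroup G} {S : Set ι} (hS : S.Finite) (X : ι → Set G)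
    (hX : ∀ i ∈ S, HFin H (X i)) : HFin H (⋃ i ∈ S, X i) := by
  induction S, hS using Set.Finite.induction_on with
  | empty => simpa using hfin_empty H
  | @insert a s ha hs ih =>
    rw [Set.biUnion_insert]
    exact hfin_union (hX _ (by simp)) (ih fun i hi => hX i (by simp [hi]))

theorem hfin_of_relIndex {H K : Subgroup G} (hK : K.relIndex H ≠ 0) {X : Set G}
    (hX : HFin H X) : HFin K X := by
  classical
  rw [hfin_iff] at *
  obtain ⟨F, hF⟩ := hX
  have hfin : Finite (H ⧸ K.subgroupOf H) := by
    rw [← Subgroup.finiteIndex_iff_finite_quotient]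
    exact ⟨hK⟩
  have := Fintype.ofFinite (H ⧸ K.subgroupOf H)
  refine ⟨Finset.univ.biUnion fun q : H ⧸ K.subgroupOf H =>
    F.image fun f => ((q.out : H) : G)⁻¹ * f, ?_⟩
  intro x hx
  obtain ⟨f, hf, h, hh, rfl⟩ := hF x hx
  let h' : H := ⟨h, hh⟩
  let q : H ⧸ K.subgroupOf H := QuotientGroup.mk h'⁻¹
  refine ⟨((q.out : H) : G)⁻¹ * f, ?_, h * (q.out : H), ?_, by group⟩
  · simp only [Finset.mem_biUnion, Finset.mem_univ, true_and, Finset.mem_image]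
    exact ⟨q, f, hf, rfl⟩
  · have : (QuotientGroup.mk h'⁻¹ : H ⧸ K.subgroupOf H) = QuotientGroup.mk q.out :=
      (QuotientGroup.out_eq' q).symm
    rw [QuotientGroup.eq] at this
    simpa [Subgroup.mem_subgroupOf, h'] using this

end HFinLemmas

section TreeLemmas

variable {V : Type*} {T : SimpleGraph V}

theorem mem_halfTree_of_walk {u v w : V} (p : T.Walk v w) (hp : s(u, v) ∉ p.edges) :
    w ∈ halfTree T u v := by
  classical
  exact ⟨p.bypass, p.bypass_isPath, fun h => hp (p.edges_bypass_subset_edges h)⟩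

theorem right_mem_halfTree (u v : V) : v ∈ halfTree T u v :=
  ⟨SimpleGraph.Walk.nil, by simp, by simp⟩

theorem not_mem_halfTree_of_cons (hT : T.IsTree) {u v w : V} (h : T.Adj v u) (q : T.Walk u w)
    (hq : (SimpleGraph.Walk.cons h q).IsPath) : w ∉ halfTree T u v := by
  rintro ⟨p, hp, hpe⟩
  have := (hT.existsUnique_path v w).unique hp hq
  subst this
  apply hpe
  simp [Sym2.eq_swap]

theorem left_not_mem_halfTree (hT : T.IsTree) {u v : V} (h : T.Adj u v) :
    u ∉ halfTree T u v := by
  apply not_mem_halfTree_of_cons hT h.symm SimpleGraph.Walk.nil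
  simpa using h.ne'

theorem halfTree_boundary {u v x y : V} (hx : x ∈ halfTree T u v)
    (hy : y ∉ halfTree T u v) (hxy : T.Adj x y) : s(x, y) = s(u, v) := by
  obtain ⟨p, hp, hpe⟩ := hx
  by_contra hne
  apply hy
  apply mem_halfTree_of_walk (p.concat hxy)
  rw [SimpleGraph.Walk.edges_concat]
  simp only [List.concat_eq_append, List.mem_append, List.mem_singleton, not_or]
  exact ⟨hpe, fun h => hne h.symm⟩

theorem edge_mem_of_cross {u v x y : V} (p : T.Walk x y) (hx : x ∈ halfTree T u v)
    (hy : y ∉ halfTree T u v) : s(u, v) ∈ p.edges := by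
  obtain ⟨d, hd, h1, h2⟩ := p.exists_boundary_dart _ hx hy
  rw [← halfTree_boundary h1 h2 d.adj]
  exact List.mem_map_of_mem hd

theorem edge_mem_of_cross' {u v x y : V} (p : T.Walk x y) (hx : x ∉ halfTree T u v)
    (hy : y ∈ halfTree T u v) : s(u, v) ∈ p.edges := by
  have := edge_mem_of_cross p.reverse hy hx
  simpa using this

theorem compl_halfTree_convex (hT : T.IsTree) {u v x y w : V} (hx : x ∉ halfTree T u v)
    (hy : y ∉ halfTree T u v) (hw : Btw T x w y) : w ∉ halfTree T u v := by
  classical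
  intro hwA
  obtain ⟨p, hp, -⟩ := hT.existsUnique_path x y
  have hwp := hw p hp
  have h1 := edge_mem_of_cross' (p.takeUntil w hwp) hx hwA
  have h2 := edge_mem_of_cross (p.dropUntil w hwp) hwA hy
  have h3 : p.edges.Nodup := hp.isTrail.edges_nodup
  rw [← p.take_spec hwp, SimpleGraph.Walk.edges_append] at h3
  exact (List.nodup_append.1 h3).2.2 _ h1 _ h2 rfl

theorem halfTree_connected {u v w : V} {S : Set V} (hv : v ∈ S) (hw : w ∈ halfTree T u v)
    (hwS : w ∉ S) : ∃ x y, T.Adj x y ∧ x ∈ S ∧ y ∉ S ∧ x ∈ halfTree T u v := by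
  classical
  obtain ⟨p, hp, hpe⟩ := hw
  obtain ⟨d, hd, h1, h2⟩ := p.exists_boundary_dart _ hv hwS
  refine ⟨d.fst, d.snd, d.adj, h1, h2, ?_⟩
  have hs := p.dart_fst_mem_support_of_mem_darts hd
  apply mem_halfTree_of_walk (p.takeUntil _ hs)
  exact fun h => hpe (p.edges_takeUntil_subset_edges hs h)

theorem halfTree_subset (hT : T.IsTree) {u v w : V} (hvw : T.Adj v w)
    (hne : w ≠ u) : halfTree T v w ⊆ halfTree T u v := by
  classical
  rintro x ⟨q, hq, hqe⟩
  apply mem_halfTree_of_walk (SimpleGraph.Walk.cons hvw q)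
  rw [SimpleGraph.Walk.edges_cons, List.mem_cons, not_or]
  constructor
  · intro h
    rw [Sym2.eq_iff] at h
    rcases h with ⟨h1, h2⟩ | ⟨h1, h2⟩
    · exact hvw.ne h2
    · exact hne h1.symm
  · intro h
    have hs := q.snd_mem_support_of_mem_edges h
    apply left_not_mem_halfTree hT hvw
    apply mem_halfTree_of_walk (q.takeUntil _ hs)
    exact fun h => hqe (q.edges_takeUntil_subset_edges hs h)

theorem eq_empty_or_univ (hT : T.IsTree) {S : Set V} (h : cobdry T S = ∅) :
    S = ∅ ∨ S = Set.univ := by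
  by_contra hc
  push Not at hc
  obtain ⟨⟨a, ha⟩, h2⟩ := hc
  obtain ⟨b, hb⟩ := (Set.ne_univ_iff_exists_notMem _).1 h2
  obtain ⟨p⟩ := hT.1 a b
  obtain ⟨d, hd, h1, h2⟩ := p.exists_boundary_dart _ ha hb
  have : d.edge ∈ cobdry T S := ⟨d.edge_mem, d.fst, d.snd, rfl, h1, h2⟩
  simp [h] at this

theorem mem_cobdry {S : Set V} {x y : V} (h : T.Adj x y) (hS : ¬ (x ∈ S ↔ y ∈ S)) :
    s(x, y) ∈ cobdry T S := by
  by_cases hx : x ∈ S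
  · have hy : y ∉ S := by tauto
    exact ⟨h, x, y, rfl, hx, hy⟩
  · have hy : y ∈ S := by tauto
    exact ⟨h, y, x, Sym2.eq_swap, hy, hx⟩

theorem iff_of_not_mem_cobdry {S : Set V} {x y : V} (h : T.Adj x y)
    (hS : s(x, y) ∉ cobdry T S) : (x ∈ S ↔ y ∈ S) := by
  by_contra hc
  exact hS (mem_cobdry h hc)

/-- To bound a coboundary it is enough to look at edges. -/
theorem cobdry_subset {S : Set V} {F : Set (Sym2 V)}
    (h : ∀ x y, T.Adj x y → s(x, y) ∉ F → x ∈ S → y ∈ S) : cobdry T S ⊆ F := by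
  rintro e ⟨he, x, y, rfl, hx, hy⟩
  by_contra hF
  exact hy (h x y he hF hx)

theorem isSpecialForest_compl {S : Set V} {Y : Set (Sym2 V)} (h : IsSpecialForest T S Y) :
    IsSpecialForest T Sᶜ Y := by
  have : cobdry T Sᶜ ⊆ cobdry T S := cobdry_subset fun x y hxy hF hx hy =>
    hx ((iff_of_not_mem_cobdry hxy hF).2 hy)
  exact ⟨h.1.subset this, this.trans h.2⟩

theorem isSpecialForest_inter {S S' : Set V} {Y : Set (Sym2 V)} (h : IsSpecialForest T S Y)
    (h' : IsSpecialForest T S' Y) : IsSpecialForest T (S ∩ S') Y := by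
  have : cobdry T (S ∩ S') ⊆ cobdry T S ∪ cobdry T S' := cobdry_subset fun x y hxy hF hx => by
    simp only [Set.mem_union, not_or] at hF
    exact ⟨(iff_of_not_mem_cobdry hxy hF.1).1 hx.1, (iff_of_not_mem_cobdry hxy hF.2).1 hx.2⟩
  exact ⟨(h.1.union h'.1).subset this, this.trans (Set.union_subset h.2 h'.2)⟩

theorem isSpecialForest_symmDiff {S S' : Set V} {Y : Set (Sym2 V)} (h : IsSpecialForest T S Y)
    (h' : IsSpecialForest T S' Y) : IsSpecialForest T (S ∆ S') Y := by
  have : cobdry T (S ∆ S') ⊆ cobdry T S ∪ cobdry T S' := cobdry_subset fun x y hxy hF hx => by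
    simp only [Set.mem_union, not_or] at hF
    have h1 := iff_of_not_mem_cobdry hxy hF.1
    have h2 := iff_of_not_mem_cobdry hxy hF.2
    rw [Set.mem_symmDiff] at *
    tauto
  exact ⟨(h.1.union h'.1).subset this, this.trans (Set.union_subset h.2 h'.2)⟩

theorem isSpecialForest_halfTree {u v : V} {Y : Set (Sym2 V)} (h : s(u, v) ∈ Y) :
    IsSpecialForest T (halfTree T u v) Y := by
  have : cobdry T (halfTree T u v) ⊆ {s(u, v)} := cobdry_subset fun x y hxy hF hx => by
    by_contra hy
    exact hF (halfTree_boundary hx hy hxy)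
  exact ⟨(Set.finite_singleton _).subset this, this.trans (by simpa using h)⟩

end TreeLemmas

section ActLemmas

variable {G V : Type*} [Group G] [MulAction G V] {T : SimpleGraph V}

/-- The graph homomorphism given by a group element. -/
def actHom (hact : ActsOn T G) (g : G) : T →g T where
  toFun := (g • ·)
  map_rel' := fun {u v} h => hact g u v h

theorem dist_smul_le (hT : T.IsTree) (hact : ActsOn T G) (g : G) (x y : V) :
    T.dist (g • x) (g • y) ≤ T.dist x y := by
  obtain ⟨p, hp⟩ := hT.1.exists_walk_length_eq_dist x y
  rw [← hp, ← p.length_map (actHom hact g)]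
  exact SimpleGraph.dist_le _

theorem btw_smul (hact : ActsOn T G) (g : G) {x w y : V} (h : Btw T x w y) :
    Btw T (g • x) (g • w) (g • y) := by
  intro p hp
  have hinj : Function.Injective (actHom hact g⁻¹) := MulAction.injective g⁻¹
  have key : ∀ x' y' (q : T.Walk x' y'), q.IsPath → x' = x → y' = y → w ∈ q.support := by
    rintro x' y' q hq rfl rfl
    exact h q hq
  have := key _ _ _ (SimpleGraph.Walk.map_isPath_of_injective hinj hp)
    (inv_smul_smul g x) (inv_smul_smul g y)
  rw [SimpleGraph.Walk.support_map, List.mem_map] at this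
  obtain ⟨a, ha, hw⟩ := this
  have hw' : g⁻¹ • a = w := hw
  rw [← hw', smul_inv_smul]
  exact ha

theorem orbit_meets_halfTree (hT : T.IsTree) (hact : ActsOn T G) (hmin : MinimalAction T G)
    (v₀ u v : V) : ∃ g : G, g • v₀ ∈ halfTree T u v := by
  by_contra hc
  push Not at hc
  have := hmin {w | ∀ g : G, g • w ∉ halfTree T u v} ⟨v₀, hc⟩
    (fun g a ha k => by rw [smul_smul]; exact ha _)
    (fun x hx y hy w hw g => compl_halfTree_convex hT (hx g) (hy g) (btw_smul hact g hw))
  have h2 : v ∈ {w | ∀ g : G, g • w ∉ halfTree T u v} := by rw [this]; trivial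
  have h3 := h2 1
  rw [one_smul] at h3
  exact h3 (right_mem_halfTree u v)

theorem no_leaf (hT : T.IsTree) (hact : ActsOn T G) (hinv : NoInversions T G)
    (hmin : MinimalAction T G) {u v : V} (h : T.Adj u v) : ∃ w, T.Adj v w ∧ w ≠ u := by
  by_contra hc
  push Not at hc
  obtain ⟨g, p, hp, hpe⟩ := orbit_meets_halfTree (G := G) hT hact hmin u u v
  have hg : g • u = v := by
    generalize hx : g • u = x at p
    cases p with
    | nil => rfl
    | cons h' q =>
      exfalso
      have := hc _ h'
      subst this
      apply hpe
      simp [Sym2.eq_swap]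
  have h2 := hact g _ _ h
  rw [hg] at h2
  exact hinv g u v h ⟨hg, hc _ h2⟩

theorem far_halfTree (hT : T.IsTree) (hact : ActsOn T G) (hinv : NoInversions T G)
    (hmin : MinimalAction T G) (r : V) {u v : V} (h : T.Adj u v) (hr : r ∉ halfTree T u v)
    (n : ℕ) : ∃ u' v', T.Adj u' v' ∧ halfTree T u' v' ⊆ halfTree T u v ∧
      ∀ w ∈ halfTree T u' v', n ≤ T.dist r w := by
  classical
  induction n with
  | zero => exact ⟨u, v, h, subset_rfl, by simp⟩
  | succ n ih =>
    obtain ⟨u', v', h', hsub, hd⟩ := ih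
    obtain ⟨w', hw', hne⟩ := no_leaf hT hact hinv hmin h'
    have hs := halfTree_subset hT hw' hne
    refine ⟨v', w', hw', hs.trans hsub, fun w hw => ?_⟩
    obtain ⟨p, hp⟩ := hT.1.exists_walk_length_eq_dist r w
    have he := edge_mem_of_cross' p (fun h => hr (hsub (hs h))) hw
    have hsupp := p.fst_mem_support_of_mem_edges he
    have hlen := congrArg SimpleGraph.Walk.length (p.take_spec hsupp)
    rw [SimpleGraph.Walk.length_append] at hlen
    have h1 : n ≤ (p.takeUntil _ hsupp).length :=
      (hd v' (right_mem_halfTree _ _)).trans (SimpleGraph.dist_le _)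
    have h2 : (p.dropUntil _ hsupp).length ≠ 0 := by
      intro h0
      have := SimpleGraph.Walk.eq_of_length_eq_zero h0
      subst this
      exact left_not_mem_halfTree hT hw' hw
    omega

theorem infinite_verts (hT : T.IsTree) (hact : ActsOn T G) (hinv : NoInversions T G)
    (hmin : MinimalAction T G) {u v : V} (h : T.Adj u v) : Infinite V := by
  by_contra hfin
  rw [not_infinite_iff_finite] at hfin
  obtain ⟨N, hN⟩ := (Set.finite_range (T.dist u)).bddAbove
  obtain ⟨u', v', -, -, hd⟩ := far_halfTree (G := G) hT hact hinv hmin u h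
    (left_not_mem_halfTree hT h) (N + 1)
  have h1 := hd v' (right_mem_halfTree _ _)
  have h2 := hN ⟨v', rfl⟩
  omega

theorem mem_edgeStab_iff (hinv : NoInversions T G) {u v : V} (h : T.Adj u v) (g : G) :
    g ∈ edgeStab G s(u, v) ↔ g • u = u ∧ g • v = v := by
  change Sym2.map (g • ·) s(u, v) = s(u, v) ↔ _
  rw [Sym2.map_mk, Sym2.eq_iff]
  constructor
  · rintro (h1 | h1)
    · exact h1
    · exact absurd h1 (hinv g u v h)
  · exact Or.inl

/-- The main implication: `X_S` being `H`-finite forces `S` to be finite. -/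
theorem finite_of_hfin (hT : T.IsTree) (hact : ActsOn T G) (hinv : NoInversions T G)
    (hmin : MinimalAction T G) (v₀ : V) {Y : Set (Sym2 V)} (hY : IsCylinder T G Y)
    {H : Subgroup G} (hH : InClassOf G Y H) {S : Set V} (hS : IsSpecialForest T S Y)
    (hX : HFin H (XS G v₀ S)) : S.Finite := by
  classical
  obtain ⟨e, heY, hcomm⟩ := hH
  have he := hY.2.1 heY
  have hX' : HFin (edgeStab G e) (XS G v₀ S) := hfin_of_relIndex hcomm.2 hX
  induction e using Sym2.ind with
  | _ r r' =>
  rw [hfin_iff] at hX'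
  obtain ⟨F, hF⟩ := hX'
  have hbound : ∀ g : G, g • v₀ ∈ S → T.dist r (g • v₀) ≤ F.sup fun f => T.dist r (f • v₀) := by
    intro g hg
    obtain ⟨f, hf, h, hh, rfl⟩ := hF g hg
    have hr := ((mem_edgeStab_iff hinv he h).1 hh).1
    have h1 := dist_smul_le hT hact h r (f • v₀)
    rw [hr, smul_smul] at h1
    exact h1.trans (Finset.le_sup (f := fun f => T.dist r (f • v₀)) hf)
  choose P hP using fun x => (hT.existsUnique_path r x).exists
  have hfinE : {x | ∃ e ∈ cobdry T S, x ∈ e}.Finite := by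
    have : {x | ∃ e ∈ cobdry T S, x ∈ e} = ⋃ e ∈ cobdry T S, {x | x ∈ e} := by ext; simp
    rw [this]
    refine hS.1.biUnion fun e _ => ?_
    induction e using Sym2.ind with
    | _ a b =>
    exact (Set.toFinite {a, b}).subset fun x hx => by simpa using hx
  have hfin2 : (⋃ x ∈ {x | ∃ e ∈ cobdry T S, x ∈ e}, {y | y ∈ (P x).support}).Finite :=
    hfinE.biUnion fun x _ => List.finite_toSet _
  refine ((Set.finite_singleton r).union hfin2).subset fun s hs => ?_
  by_cases hsr : s = r
  · exact Or.inl hsr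
  right
  obtain ⟨p, hp, -⟩ := hT.existsUnique_path s r
  cases p with
  | nil => exact absurd rfl hsr
  | @cons _ u _ h q =>
  have hr := not_mem_halfTree_of_cons hT h q hp
  obtain ⟨u', v', -, hsub, hd⟩ := far_halfTree (G := G) hT hact hinv hmin r h.symm hr
    ((F.sup fun f => T.dist r (f • v₀)) + 1)
  obtain ⟨g, hg⟩ := orbit_meets_halfTree (G := G) hT hact hmin v₀ u' v'
  have hgS : g • v₀ ∉ S := fun hgS => by
    have h1 := hbound g hgS
    have h2 := hd _ hg
    omega
  obtain ⟨x, y, hxy, hx, hy, hxA⟩ := halfTree_connected hs (hsub hg) hgS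
  simp only [Set.mem_iUnion]
  refine ⟨x, ⟨s(x, y), mem_cobdry hxy (by tauto), by simp⟩, ?_⟩
  exact (P x).snd_mem_support_of_mem_edges (edge_mem_of_cross' (P x) hr hxA)

theorem comm_stab_edge (hinv : NoInversions T G) (hact : ActsOn T G) {s t : V} (h : T.Adj s t)
    (hfin : {x | T.Adj s x}.Finite) :
    Subgroup.Commensurable (MulAction.stabilizer G s) (edgeStab G s(s, t)) := by
  have hle : edgeStab G s(s, t) ≤ MulAction.stabilizer G s := fun g hg =>
    ((mem_edgeStab_iff hinv h g).1 hg).1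
  refine Subgroup.Commensurable.symm ⟨?_, ?_⟩
  · have heq : edgeStab G s(s, t) = MulAction.stabilizer G s ⊓ MulAction.stabilizer G t := by
      ext g
      rw [mem_edgeStab_iff hinv h]
      rfl
    rw [heq, Subgroup.inf_relIndex_left, Subgroup.relIndex]
    have : (MulAction.stabilizer G t).subgroupOf (MulAction.stabilizer G s)
        = MulAction.stabilizer (MulAction.stabilizer G s) t := by
      ext g
      rfl
    rw [this, MulAction.index_stabilizer]
    have hsub : MulAction.orbit (MulAction.stabilizer G s) t ⊆ {x | T.Adj s x} := by
      rintro _ ⟨g, rfl⟩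
      have h1 := hact (g : G) _ _ h
      rw [g.2] at h1
      exact h1
    exact ((Set.ncard_pos (hfin.subset hsub)).2 (MulAction.nonempty_orbit t)).ne'
  · rw [Subgroup.relIndex_eq_one.2 hle]
    exact one_ne_zero

theorem comm_stab_walk (hinv : NoInversions T G) (hact : ActsOn T G) {S : Set V}
    (hval : ∀ s ∈ S, {x | T.Adj s x}.Finite) {s w : V} (p : T.Walk s w) (hs : s ∈ S)
    (hw : w ∉ S) : ∃ e ∈ cobdry T S,
      Subgroup.Commensurable (MulAction.stabilizer G s) (edgeStab G e) := by
  induction p with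
  | nil => exact absurd hs hw
  | @cons s t w h q ih =>
    have h1 := comm_stab_edge (G := G) hinv hact h (hval s hs)
    by_cases ht : t ∈ S
    · obtain ⟨e, he, hc⟩ := ih ht hw
      have h2 := comm_stab_edge (G := G) hinv hact h.symm (hval t ht)
      rw [Sym2.eq_swap] at h2
      exact ⟨e, he, h1.trans (h2.symm.trans hc)⟩
    · exact ⟨s(s, t), ⟨h, s, t, rfl, hs, ht⟩, h1⟩

theorem hfin_of_finite (hT : T.IsTree) (hact : ActsOn T G) (hinv : NoInversions T G)
    (hmin : MinimalAction T G) (v₀ : V) {Y : Set (Sym2 V)} (hY : IsCylinder T G Y)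
    {H : Subgroup G} (hH : InClassOf G Y H) {S : Set V} (hS : IsSpecialForest T S Y)
    (hfin : S.Finite) : HFin H (XS G v₀ S) := by
  obtain ⟨e, heY, hcomm⟩ := hH
  have he := hY.2.1 heY
  have hinf : Infinite V := by
    induction e using Sym2.ind with
    | _ r r' => exact infinite_verts (G := G) hT hact hinv hmin he
  obtain ⟨w, hw⟩ := hfin.exists_notMem
  have hval : ∀ s ∈ S, {x | T.Adj s x}.Finite := by
    intro s hs
    have h1 : {x | s(s, x) ∈ cobdry T S}.Finite :=
      hS.1.preimage fun a _ b _ hab => Sym2.congr_right.1 hab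
    refine (hfin.union h1).subset fun x hx => ?_
    by_cases hxS : x ∈ S
    · exact Or.inl hxS
    · exact Or.inr ⟨hx, s, x, rfl, hs, hxS⟩
  have : XS G v₀ S = ⋃ s ∈ S, {g : G | g • v₀ = s} := by
    ext g
    simp [XS]
  rw [this]
  refine hfin_biUnion hfin _ fun s hs => ?_
  obtain ⟨p⟩ := hT.1 s w
  obtain ⟨e', he', hc⟩ := comm_stab_walk (G := G) hinv hact hval p hs hw
  have he'Y := hS.2 he'
  have hc2 := (hY.2.2 e heY e' (hY.2.1 he'Y)).1 he'Y
  have hc3 : Subgroup.Commensurable H (MulAction.stabilizer G s) :=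
    hcomm.trans (hc2.trans hc.symm)
  apply hfin_of_relIndex hc3.1
  by_cases hex : ∃ g₀ : G, g₀ • v₀ = s
  · obtain ⟨g₀, hg₀⟩ := hex
    rw [hfin_iff]
    refine ⟨{g₀}, fun g hg => ⟨g₀, by simp, g * g₀⁻¹, ?_, by group⟩⟩
    have hg' : g • v₀ = s := hg
    rw [MulAction.mem_stabilizer_iff, mul_smul, ← hg₀, inv_smul_smul, hg', hg₀]
  · refine hfin_mono ?_ (hfin_empty _)
    exact fun g hg => hex ⟨g, hg⟩

theorem XS_mem_BCT (hT : T.IsTree) (v₀ : V) {Y : Set (Sym2 V)} (hY : Y.Nonempty)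
    (hYT : Y ⊆ T.edgeSet) (H : Subgroup G) (F : Set (Sym2 V)) (hF : F.Finite) (hFY : F ⊆ Y) :
    ∀ S : Set V, cobdry T S ⊆ F → XS G v₀ S ∈ BCT T v₀ Y H := by
  intro S hS
  rw [BCT, Set.mem_sInter]
  rintro B ⟨hB1, hB2, hB3, -⟩
  have hunion : ∀ X ∈ B, ∀ X' ∈ B, X ∪ X' ∈ B := fun X hX X' hX' => by
    have := hB2 _ (hB3 _ (hB2 _ hX) _ (hB2 _ hX'))
    rwa [← Set.compl_union, compl_compl] at this
  induction F, hF using Set.Finite.induction_on generalizing S with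
  | empty =>
    have hempty : (∅ : Set G) ∈ B := by
      obtain ⟨e, he⟩ := hY
      induction e using Sym2.ind with
      | _ u v =>
      have h1 := hB1 u v (hYT he) he
      have := hB3 _ h1 _ (hB2 _ h1)
      rwa [Set.inter_compl_self] at this
    rcases eq_empty_or_univ hT (Set.subset_empty_iff.1 hS) with rfl | rfl
    · exact hempty
    · have := hB2 _ hempty
      rw [Set.compl_empty] at this
      exact this
  | @insert e F' he hF' ih =>
    have heY : e ∈ Y := hFY (Set.mem_insert _ _)
    have hF'Y : F' ⊆ Y := (Set.subset_insert _ _).trans hFY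
    induction e using Sym2.ind with
    | _ u v =>
    have huv : T.Adj u v := hYT heY
    have hA := hB1 u v huv heY
    set A := halfTree T u v with hAdef
    have hvA : v ∈ A := right_mem_halfTree u v
    have huA : u ∉ A := left_not_mem_halfTree hT huv
    have key : ∀ x y, T.Adj x y → s(x, y) ≠ s(u, v) → (x ∈ A ↔ y ∈ A) := by
      intro x y hxy hne
      by_contra hc
      by_cases hx : x ∈ A
      · exact hne (halfTree_boundary hx (by tauto) hxy)
      · exact hne (Sym2.eq_swap.trans (halfTree_boundary (x := y) (y := x)
          (by tauto) hx hxy.symm))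
    have hbd : ∀ x y, T.Adj x y → s(x, y) ∉ F' → s(x, y) ≠ s(u, v) → (x ∈ S ↔ y ∈ S) := by
      intro x y hxy hF hne
      apply iff_of_not_mem_cobdry hxy
      intro hc
      rcases hS hc with h | h
      · exact hne h
      · exact hF h
    have h1 : XS G v₀ {x | (x ∈ A ∧ x ∈ S) ∨ (x ∉ A ∧ v ∈ S)} ∈ B := by
      refine ih hF'Y _ (cobdry_subset fun x y hxy hF hx => ?_)
      simp only [Set.mem_ofPred_eq] at *
      by_cases hne : s(x, y) = s(u, v)
      · rcases Sym2.eq_iff.1 hne with ⟨rfl, rfl⟩ | ⟨rfl, rfl⟩ <;> tauto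
      · have := key x y hxy hne
        have := hbd x y hxy hF hne
        tauto
    have h2 : XS G v₀ {x | (x ∉ A ∧ x ∈ S) ∨ (x ∈ A ∧ u ∈ S)} ∈ B := by
      refine ih hF'Y _ (cobdry_subset fun x y hxy hF hx => ?_)
      simp only [Set.mem_ofPred_eq] at *
      by_cases hne : s(x, y) = s(u, v)
      · rcases Sym2.eq_iff.1 hne with ⟨rfl, rfl⟩ | ⟨rfl, rfl⟩ <;> tauto
      · have := key x y hxy hne
        have := hbd x y hxy hF hne
        tauto
    have h3 := hunion _ (hB3 _ h1 _ hA) _ (hB3 _ h2 _ (hB2 _ hA))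
    convert h3 using 1
    ext g
    simp only [XS, Ze, Set.mem_ofPred_eq, Set.mem_union, Set.mem_inter_iff, Set.mem_compl_iff,
      ← hAdef]
    tauto

theorem exists_of_mem_BCT (v₀ : V) {Y : Set (Sym2 V)} (H : Subgroup G) :
    ∀ X ∈ BCT T v₀ Y H, ∃ S : Set V, IsSpecialForest T S Y ∧ HFin H (X ∆ XS G v₀ S) := by
  intro X hX
  rw [BCT, Set.mem_sInter] at hX
  refine hX {X | ∃ S : Set V, IsSpecialForest T S Y ∧ HFin H (X ∆ XS G v₀ S)} ⟨?_, ?_, ?_, ?_⟩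
  · intro u v _ huv
    refine ⟨halfTree T u v, isSpecialForest_halfTree huv, ?_⟩
    rw [Ze, symmDiff_self]
    exact hfin_empty H
  · rintro X ⟨S, hS, hX⟩
    refine ⟨Sᶜ, isSpecialForest_compl hS, hfin_mono ?_ hX⟩
    intro g hg
    simp only [Set.mem_symmDiff, XS, Set.mem_ofPred_eq, Set.mem_compl_iff] at *
    tauto
  · rintro X ⟨S, hS, hX⟩ X' ⟨S', hS', hX'⟩
    refine ⟨S ∩ S', isSpecialForest_inter hS hS', hfin_mono ?_ (hfin_union hX hX')⟩
    intro g hg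
    simp only [Set.mem_symmDiff, XS, Set.mem_ofPred_eq, Set.mem_inter_iff, Set.mem_union] at *
    tauto
  · rintro X ⟨S, hS, hX⟩ X' hXX'
    refine ⟨S, hS, hfin_mono ?_ (hfin_union hX hXX')⟩
    intro g hg
    simp only [Set.mem_symmDiff, Set.mem_union] at *
    tauto

end ActLemmas


/-- The map `S ↦ [X_S]` induces an isomorphism of Boolean algebras from
the algebra of equivalence classes of special forests based on `Y` onto `B_C(T)`:
it is a morphism for the Boolean operations, it is well defined and injective on classes,
its image is exactly `B_C(T)`, and `X_S` is `H`-finite iff `S` is finite (`H` in the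
commensurability class `C` of `Y`). -/
theorem stmt_3 {G V : Type*} [Group G] [MulAction G V]
    (hGfg : Group.FG G)
    (T : SimpleGraph V) (hT : T.IsTree) (hact : ActsOn T G) (hinv : NoInversions T G)
    (E : Set (Subgroup G)) (hE : Admissible E) (hET : IsETree T G E)
    (hmin : MinimalAction T G) (v₀ : V)
    (Y : Set (Sym2 V)) (hY : IsCylinder T G Y) :
    -- morphism of Boolean algebras (on representatives)
    (∀ S S' : Set V, XS G v₀ (S ∩ S') = XS G v₀ S ∩ XS G v₀ S' ∧
        XS G v₀ (Sᶜ) = (XS G v₀ S)ᶜ) ∧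
    -- well defined and injective on equivalence classes
    (∀ H : Subgroup G, InClassOf G Y H →
      ∀ S S' : Set V, IsSpecialForest T S Y → IsSpecialForest T S' Y →
        ((S ∆ S').Finite ↔ HFin H (XS G v₀ S ∆ XS G v₀ S'))) ∧
    -- the image is exactly `B_C(T)`
    (∀ H : Subgroup G, InClassOf G Y H →
      (∀ S : Set V, IsSpecialForest T S Y → XS G v₀ S ∈ BCT T v₀ Y H) ∧
      (∀ X ∈ BCT T v₀ Y H, ∃ S : Set V, IsSpecialForest T S Y ∧ HFin H (X ∆ XS G v₀ S))) ∧
    -- in particular: `X_S` is `H`-finite iff `S` is finite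
    (∀ H : Subgroup G, InClassOf G Y H →
      ∀ S : Set V, IsSpecialForest T S Y → (HFin H (XS G v₀ S) ↔ S.Finite)) := by
  have hmain : ∀ H : Subgroup G, InClassOf G Y H →
      ∀ S : Set V, IsSpecialForest T S Y → (HFin H (XS G v₀ S) ↔ S.Finite) :=
    fun H hH S hS => ⟨finite_of_hfin hT hact hinv hmin v₀ hY hH hS,
      hfin_of_finite hT hact hinv hmin v₀ hY hH hS⟩
  refine ⟨fun S S' => ⟨rfl, rfl⟩, ?_, ?_, hmain⟩
  · intro H hH S S' hS hS'
    exact (hmain H hH _ (isSpecialForest_symmDiff hS hS')).symm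
  · intro H _
    exact ⟨fun S hS => XS_mem_BCT hT v₀ hY.1 hY.2.1 H _ hS.1 hS.2 S subset_rfl,
      exists_of_mem_BCT v₀ H⟩

end SSRN
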